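/- Let θ ∈ ℝ, let v ≥ 0 be a variance, and let K ∈ ℕ. Define C_{K,j} := (K.choose (2*j)) * ((2*j)! / (j! * 2^j)). Then ∫ ( Σ_{j=0}^{⌊K/2⌋} C_{K,j} * (−1)^j * v^j * x^(K−2*j) ) d(gaussianReal θ v)(x) = θ^K. In other words, the polynomial statistic Σ_j C_{K,j}(−1)^j v^j X^{K−2j} of an observation X ~ N(θ, v) is an unbiased estimator of θ^K. -/

import Mathlib

open MeasureTheory ProbabilityTheory
open scoped NNReal

/-- Differentiating `exp (a t + b t² / 2)` repeatedly gives a two-term recurrence. -/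
lemma iteratedDeriv_succ_exp_quadratic (a b : ℝ) (n : ℕ) (t : ℝ) :
    iteratedDeriv (n + 1) (fun t ↦ Real.exp (a * t + b * t ^ 2 / 2)) t
      = (a + b * t) * iteratedDeriv n (fun t ↦ Real.exp (a * t + b * t ^ 2 / 2)) t
        + n * b * iteratedDeriv (n - 1) (fun t ↦ Real.exp (a * t + b * t ^ 2 / 2)) t := by
  set f : ℝ → ℝ := fun t ↦ Real.exp (a * t + b * t ^ 2 / 2) with hf
  have hsmooth : ContDiff ℝ ⊤ f := by fun_prop
  have hderiv (m : ℕ) (s : ℝ) :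
      HasDerivAt (iteratedDeriv m f) (iteratedDeriv (m + 1) f s) s := by
    rw [iteratedDeriv_succ]
    exact (hsmooth.differentiable_iteratedDeriv m
      (WithTop.coe_lt_top (m : ℕ∞)) s).hasDerivAt
  have hlin (s : ℝ) : HasDerivAt (fun s ↦ a + b * s) b s := by
    simpa using ((hasDerivAt_id s).const_mul b).const_add a
  induction n generalizing t with
  | zero =>
    have hquad : HasDerivAt (fun t ↦ a * t + b * t ^ 2 / 2) (a + b * t) t := by
      refine (((hasDerivAt_id t).const_mul a).add
        ((((hasDerivAt_id t).pow 2).const_mul b).div_const 2)).congr_deriv ?_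
      simp
      ring
    simp [iteratedDeriv_succ, hf, hquad.exp.deriv, mul_comm]
  | succ n ih =>
    have hsucc := hderiv (n + 1) t
    rw [show iteratedDeriv (n + 1) f = _ from funext ih] at hsucc
    refine (hsucc.unique (((hlin t).mul (hderiv n t)).add
      ((hderiv (n - 1) t).const_mul (n * b)))).trans ?_
    cases n with
    | zero => simp; ring
    | succ n => push_cast; ring

lemma integrable_pow_gaussianReal (θ : ℝ) (v : ℝ≥0) (n : ℕ) :
    Integrable (fun x ↦ x ^ n) (gaussianReal θ v) :=
  integrable_pow_of_mem_interior_integrableExpSet (X := id) (by simp) n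

/-- The moments of a real Gaussian satisfy a two-term recurrence. -/
lemma integral_pow_succ_gaussianReal (θ : ℝ) (v : ℝ≥0) (n : ℕ) :
    ∫ x, x ^ (n + 1) ∂(gaussianReal θ v)
      = θ * ∫ x, x ^ n ∂(gaussianReal θ v)
        + n * v * ∫ x, x ^ (n - 1) ∂(gaussianReal θ v) := by
  have hmoment (m : ℕ) : ∫ x, x ^ m ∂(gaussianReal θ v)
      = iteratedDeriv m (fun t ↦ Real.exp (θ * t + v * t ^ 2 / 2)) 0 := by
    rw [← mgf_id_gaussianReal, iteratedDeriv_mgf_zero (by simp)]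
    simp
  simp only [hmoment, iteratedDeriv_succ_exp_quadratic, mul_zero, add_zero]

lemma factorial_two_mul_div (j : ℕ) :
    (2 * j).factorial / (j.factorial * 2 ^ j) = ∏ i ∈ Finset.range j, (2 * i + 1) := by
  refine Nat.div_eq_of_eq_mul_left (by positivity) ?_
  induction j with
  | zero => simp
  | succ j ih =>
    rw [mul_add, mul_one, Nat.factorial_succ, Nat.factorial_succ, ih, Finset.prod_range_succ,
      Nat.factorial_succ]
    ring

/-- The number of `j`-edge matchings in the complete graph on `K` vertices. -/
def matchingCount (K j : ℕ) : ℕ :=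
  K.choose (2 * j) * ∏ i ∈ Finset.range j, (2 * i + 1)

lemma matchingCount_zero_right (K : ℕ) : matchingCount K 0 = 1 := by
  simp [matchingCount]

lemma matchingCount_eq_zero {K j : ℕ} (h : K < 2 * j) : matchingCount K j = 0 := by
  simp [matchingCount, Nat.choose_eq_zero_of_lt h]

lemma matchingCount_succ_succ (K j : ℕ) :
    matchingCount (K + 1) (j + 1)
      = matchingCount K (j + 1) + (K - 2 * j) * matchingCount K j := by
  have h := Nat.choose_succ_right_eq K (2 * j)
  simp only [matchingCount, Finset.prod_range_succ, mul_add, mul_one, Nat.choose_succ_succ' K]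
  linear_combination (∏ i ∈ Finset.range j, (2 * i + 1)) * h

/-- A sequence with the Gaussian moment recurrence is debiased by the Hermite coefficients. -/
lemma sum_matchingCount_mul_of_recurrence {M : ℕ → ℝ} {θ v : ℝ} (h0 : M 0 = 1)
    (hM : ∀ n, M (n + 1) = θ * M n + n * v * M (n - 1)) (K : ℕ) {N : ℕ} (hN : K < 2 * N) :
    ∑ j ∈ Finset.range N, (matchingCount K j : ℝ) * (-v) ^ j * M (K - 2 * j) = θ ^ K := by
  induction K generalizing N with
  | zero =>
    obtain ⟨N, rfl⟩ : ∃ n, N = n + 1 := ⟨N - 1, by omega⟩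
    rw [Finset.sum_range_succ', Finset.sum_eq_zero]
    · simp [matchingCount_zero_right, h0]
    · intro j _
      simp [matchingCount_eq_zero (K := 0) (j := j + 1) (by omega)]
  | succ K ih =>
    obtain ⟨N, rfl⟩ : ∃ n, N = n + 1 := ⟨N - 1, by omega⟩
    have hstep (j : ℕ) : (matchingCount K j : ℝ) * M (K + 1 - 2 * j)
        = matchingCount K j * (θ * M (K - 2 * j)
          + (K - 2 * j : ℕ) * v * M (K + 1 - 2 * (j + 1))) := by
      by_cases h : K < 2 * j
      · simp [matchingCount_eq_zero h]
      · rw [show K + 1 - 2 * j = K - 2 * j + 1 by omega, hM,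
          show K - 2 * j - 1 = K + 1 - 2 * (j + 1) by omega]
    have hlast : ((K - 2 * N : ℕ) : ℝ) = 0 := by
      rw [Nat.cast_eq_zero]; omega
    calc
      _ = ∑ j ∈ Finset.range (N + 1), (matchingCount K j : ℝ) * (-v) ^ j * M (K + 1 - 2 * j)
          - ∑ j ∈ Finset.range N, (matchingCount K j : ℝ) * (-v) ^ j
            * ((K - 2 * j : ℕ) * v * M (K + 1 - 2 * (j + 1))) := by
        rw [Finset.sum_range_succ', Finset.sum_range_succ' _ N, add_sub_right_comm,
          ← Finset.sum_sub_distrib]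
        congr 1
        · refine Finset.sum_congr rfl fun j _ ↦ ?_
          rw [matchingCount_succ_succ]
          push_cast
          ring
        · simp [matchingCount_zero_right]
      _ = θ * ∑ j ∈ Finset.range (N + 1), (matchingCount K j : ℝ) * (-v) ^ j * M (K - 2 * j) := by
        have hsum := Finset.sum_range_succ (fun j ↦ (matchingCount K j : ℝ) * (-v) ^ j
            * ((K - 2 * j : ℕ) * v * M (K + 1 - 2 * (j + 1)))) N
        simp only [hlast, zero_mul, mul_zero, add_zero] at hsum
        rw [← hsum, ← Finset.sum_sub_distrib, Finset.mul_sum]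
        refine Finset.sum_congr rfl fun j _ ↦ ?_
        linear_combination (-v) ^ j * hstep j
      _ = θ ^ (K + 1) := by rw [ih (by omega), pow_succ']

/-- Univariate debiasing identity: for `X ~ N(θ, v)`, the statistic
`∑_{j=0}^{⌊K/2⌋} C_{K,j} (-1)^j v^j X^(K-2j)`, with
`C_{K,j} = (K choose 2j) (2j)!/(j! 2^j)`, is an unbiased estimator of `θ^K`. -/
theorem debiased_moment_unbiased (θ : ℝ) (v : ℝ≥0) (K : ℕ) :
    ∫ x, (∑ j ∈ Finset.range (K / 2 + 1),
        ((K.choose (2 * j) * ((2 * j).factorial / (j.factorial * 2 ^ j)) : ℕ) : ℝ)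
          * (-1) ^ j * (v : ℝ) ^ j * x ^ (K - 2 * j)) ∂(gaussianReal θ v)
      = θ ^ K := by
  rw [integral_finsetSum _ fun j _ ↦ (integrable_pow_gaussianReal θ v _).const_mul _]
  simp only [integral_const_mul, factorial_two_mul_div, mul_assoc _ ((-1 : ℝ) ^ _), ← mul_pow,
    neg_one_mul]
  exact sum_matchingCount_mul_of_recurrence (M := fun n ↦ ∫ x, x ^ n ∂(gaussianReal θ v))
    (by simp) (integral_pow_succ_gaussianReal θ v) K (by omega)
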